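/- arXiv:1002.1769 — 3 statements merged into one kernel-verified Lean document; each statement's English description precedes it below -/
import Mathlib

section
/- Let s : ℝ × ℝ → ℝ be a smooth function of (y,τ), everywhere positive, satisfying s_τ = −∂_y( s_yy − (3/2)·s_y²/s ) at every point. Then the function v := −∂_y log s = −s_y/s satisfies the MKdV equation v_τ = −v_yyy + (3/2) v² v_y at every point. -/
/-- Partial derivative with respect to the first variable (y). -/
noncomputable def pdy (f : ℝ × ℝ → ℝ) : ℝ × ℝ → ℝ := fun p => deriv (fun y => f (y, p.2)) p.1

/-- Partial derivative with respect to the second variable (τ). -/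
noncomputable def pdtau (f : ℝ × ℝ → ℝ) : ℝ × ℝ → ℝ := fun p => deriv (fun t => f (p.1, t)) p.2

open scoped ContDiff in
theorem hasDerivAt_pdy {f : ℝ × ℝ → ℝ} (hf : ContDiff ℝ ∞ f) (p : ℝ × ℝ) :
    HasDerivAt (fun y => f (y, p.2)) (pdy f p) p.1 := by
  have h : ContDiff ℝ ∞ (fun y : ℝ => f (y, p.2)) := by fun_prop
  exact (h.differentiable (by simp) p.1).hasDerivAt

open scoped ContDiff in
theorem hasDerivAt_pdtau {f : ℝ × ℝ → ℝ} (hf : ContDiff ℝ ∞ f) (p : ℝ × ℝ) :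
    HasDerivAt (fun t => f (p.1, t)) (pdtau f p) p.2 := by
  have h : ContDiff ℝ ∞ (fun t : ℝ => f (p.1, t)) := by fun_prop
  exact (h.differentiable (by simp) p.2).hasDerivAt

open scoped ContDiff in
theorem pdy_eq_fderiv {f : ℝ × ℝ → ℝ} (hf : ContDiff ℝ ∞ f) :
    pdy f = fun p => fderiv ℝ f p (1, 0) := by
  funext p
  have h := (hf.differentiable (by simp) p).hasFDerivAt
  have hl : HasDerivAt (fun y : ℝ => (y, p.2)) ((1 : ℝ), (0 : ℝ)) p.1 :=
    (hasDerivAt_id p.1).prodMk (hasDerivAt_const p.1 p.2)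
  exact (h.comp_hasDerivAt p.1 hl).deriv

open scoped ContDiff in
theorem pdtau_eq_fderiv {f : ℝ × ℝ → ℝ} (hf : ContDiff ℝ ∞ f) :
    pdtau f = fun p => fderiv ℝ f p (0, 1) := by
  funext p
  have h := (hf.differentiable (by simp) p).hasFDerivAt
  have hl : HasDerivAt (fun t : ℝ => (p.1, t)) ((0 : ℝ), (1 : ℝ)) p.2 :=
    (hasDerivAt_const p.2 p.1).prodMk (hasDerivAt_id p.2)
  exact (h.comp_hasDerivAt p.2 hl).deriv

open scoped ContDiff in
theorem contDiff_pdy {f : ℝ × ℝ → ℝ} (hf : ContDiff ℝ ∞ f) : ContDiff ℝ ∞ (pdy f) := by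
  rw [pdy_eq_fderiv hf]
  exact (hf.fderiv_right (by simp)).clm_apply contDiff_const

open scoped ContDiff in
theorem contDiff_pdtau {f : ℝ × ℝ → ℝ} (hf : ContDiff ℝ ∞ f) : ContDiff ℝ ∞ (pdtau f) := by
  rw [pdtau_eq_fderiv hf]
  exact (hf.fderiv_right (by simp)).clm_apply contDiff_const

open scoped ContDiff in
theorem pdtau_pdy_comm {f : ℝ × ℝ → ℝ} (hf : ContDiff ℝ ∞ f) (p : ℝ × ℝ) :
    pdtau (pdy f) p = pdy (pdtau f) p := by
  have hd : DifferentiableAt ℝ (fderiv ℝ f) p :=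
    (hf.fderiv_right (m := ∞) (by simp)).differentiable (by simp) p
  have hsymm : IsSymmSndFDerivAt ℝ f p :=
    hf.contDiffAt.isSymmSndFDerivAt
      (by rw [minSmoothness_of_isRCLikeNormedField]; exact WithTop.coe_le_coe.2 le_top)
  rw [pdtau_eq_fderiv (contDiff_pdy hf), pdy_eq_fderiv (contDiff_pdtau hf),
    pdy_eq_fderiv hf, pdtau_eq_fderiv hf]
  simp only [fderiv_clm_apply hd (differentiableAt_const _)]
  simpa using hsymm.eq (0, 1) (1, 0)

theorem pdy_neg (f : ℝ × ℝ → ℝ) : pdy (fun p => -f p) = fun p => -pdy f p := by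
  funext p
  simp [pdy]

theorem pdtau_neg (f : ℝ × ℝ → ℝ) : pdtau (fun p => -f p) = fun p => -pdtau f p := by
  funext p
  simp [pdtau]

/-- If the positive function `s` solves the potential Schwarzian KdV equation
`s_τ = −∂_y(s_yy − (3/2) s_y²/s)`, then `v = −s_y/s` (the Cole–Hopf transform of `s`)
solves the MKdV equation `v_τ = −v_yyy + (3/2) v² v_y`. -/
theorem potential_schwarzianKdV_to_mkdv
    (s v : ℝ × ℝ → ℝ) (hs : ContDiff ℝ (⊤ : ℕ∞) s) (hpos : ∀ p, 0 < s p)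
    (hpSKdV : ∀ p : ℝ × ℝ,
      pdtau s p = -pdy (fun q => pdy (pdy s) q - (3 / 2) * (pdy s q) ^ 2 / s q) p)
    (hv : v = fun p => -(pdy s p) / s p) :
    ∀ p : ℝ × ℝ,
      pdtau v p = -pdy (pdy (pdy v)) p + (3 / 2) * (v p) ^ 2 * pdy v p := by
  intro p
  set φ : ℝ × ℝ → ℝ := fun q => Real.log (s q) with hφdef
  have hφ : ContDiff ℝ (⊤ : ℕ∞) φ := hs.log fun q => (hpos q).ne'
  have hφ₁ := contDiff_pdy hφ
  have hφ₂ := contDiff_pdy hφ₁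
  have hφ₃ := contDiff_pdy hφ₂
  have log_y (q : ℝ × ℝ) : pdy φ q = pdy s q / s q :=
    ((hasDerivAt_pdy hs q).log (hpos q).ne').deriv
  have log_tau (q : ℝ × ℝ) : pdtau φ q = pdtau s q / s q :=
    ((hasDerivAt_pdtau hs q).log (hpos q).ne').deriv
  have s_y : pdy s = fun q => s q * pdy φ q := by
    funext q
    rw [log_y, mul_div_cancel₀ _ (hpos q).ne']
  have s_yy : pdy (pdy s) = fun q => s q * (pdy (pdy φ) q + pdy φ q ^ 2) := by
    funext q
    conv_lhs => rw [s_y]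
    refine ((hasDerivAt_pdy hs q).mul (hasDerivAt_pdy hφ₁ q)).deriv.trans ?_
    rw [s_y]
    ring
  have flux : (fun q => pdy (pdy s) q - (3 / 2) * (pdy s q) ^ 2 / s q) =
      fun q => s q * (pdy (pdy φ) q - (1 / 2) * pdy φ q ^ 2) := by
    funext q
    have := (hpos q).ne'
    rw [s_yy, s_y]
    field_simp
    ring
  have φ_tau : pdtau φ =
      fun q => -(pdy (pdy (pdy φ)) q - (1 / 2) * pdy φ q ^ 3) := by
    funext q
    have hflux := ((hasDerivAt_pdy hs q).mul ((hasDerivAt_pdy hφ₂ q).sub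
      (((hasDerivAt_pdy hφ₁ q).pow 2).const_mul (1 / 2)))).deriv
    have := (hpos q).ne'
    rw [log_tau, hpSKdV, flux, div_eq_iff this, neg_mul, neg_inj]
    refine hflux.trans ?_
    rw [s_y]
    simp
    ring
  have hvφ : v = fun q => -pdy φ q := by
    rw [hv]
    funext q
    rw [log_y, neg_div]
  have φ_tau_y : pdy (pdtau φ) p =
      -(pdy (pdy (pdy (pdy φ))) p - (3 / 2) * pdy φ p ^ 2 * pdy (pdy φ) p) := by
    rw [φ_tau]
    refine ((hasDerivAt_pdy hφ₃ p).sub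
      (((hasDerivAt_pdy hφ₁ p).pow 3).const_mul (1 / 2))).neg.deriv.trans ?_
    simp
    ring
  rw [hvφ]
  simp only [pdy_neg, pdtau_neg]
  rw [pdtau_pdy_comm hφ, φ_tau_y]
  ring
end

section
/- Let w : ℝ × ℝ → ℝ be a smooth function of (x,t) satisfying the Fordy–Gibbons equation w_t = w_xxxxx − 5 w_x w_xxx − 5 w_xx² − 5 w_x³ − 20 w w_x w_xx − 5 w² w_xxx + 5 w⁴ w_x at every point. Then the function u := −w_x − (1/2) w² satisfies the Kaup–Kupershmidt equation u_t = u_xxxxx + 10 u u_xxx + 25 u_x u_xx + 20 u² u_x at every point. -/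
/-- Partial derivative with respect to the first variable (x). -/
noncomputable def pdx (f : ℝ × ℝ → ℝ) : ℝ × ℝ → ℝ := fun p => deriv (fun x => f (x, p.2)) p.1

/-- Partial derivative with respect to the second variable (t). -/
noncomputable def pdt (f : ℝ × ℝ → ℝ) : ℝ × ℝ → ℝ := fun p => deriv (fun t => f (p.1, t)) p.2

open scoped ContDiff

section PartialDerivatives

variable {f g : ℝ × ℝ → ℝ}

lemma hasDerivAt_fst_slice (hf : ContDiff ℝ ∞ f) (p : ℝ × ℝ) :
    HasDerivAt (fun x => f (x, p.2)) (fderiv ℝ f p (1, 0)) p.1 :=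
  ((hf.differentiable (by simp)) p).hasFDerivAt.comp_hasDerivAt p.1
    ((hasDerivAt_id p.1).prodMk (hasDerivAt_const p.1 p.2))

lemma hasDerivAt_snd_slice (hf : ContDiff ℝ ∞ f) (p : ℝ × ℝ) :
    HasDerivAt (fun t => f (p.1, t)) (fderiv ℝ f p (0, 1)) p.2 :=
  ((hf.differentiable (by simp)) p).hasFDerivAt.comp_hasDerivAt p.2
    ((hasDerivAt_const p.2 p.1).prodMk (hasDerivAt_id p.2))

lemma pdx_eq_fderiv (hf : ContDiff ℝ ∞ f) : pdx f = fun p => fderiv ℝ f p (1, 0) :=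
  funext fun p => (hasDerivAt_fst_slice hf p).deriv

lemma pdt_eq_fderiv (hf : ContDiff ℝ ∞ f) : pdt f = fun p => fderiv ℝ f p (0, 1) :=
  funext fun p => (hasDerivAt_snd_slice hf p).deriv

lemma contDiff_pdx (hf : ContDiff ℝ ∞ f) : ContDiff ℝ ∞ (pdx f) := by
  rw [pdx_eq_fderiv hf]
  exact (hf.fderiv_right (by simp)).clm_apply contDiff_const

lemma contDiff_pdt (hf : ContDiff ℝ ∞ f) : ContDiff ℝ ∞ (pdt f) := by
  rw [pdt_eq_fderiv hf]
  exact (hf.fderiv_right (by simp)).clm_apply contDiff_const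

lemma hasDerivAt_pdx (hf : ContDiff ℝ ∞ f) (p : ℝ × ℝ) :
    HasDerivAt (fun x => f (x, p.2)) (pdx f p) p.1 :=
  (hasDerivAt_fst_slice hf p).differentiableAt.hasDerivAt

lemma hasDerivAt_pdt (hf : ContDiff ℝ ∞ f) (p : ℝ × ℝ) :
    HasDerivAt (fun t => f (p.1, t)) (pdt f p) p.2 :=
  (hasDerivAt_snd_slice hf p).differentiableAt.hasDerivAt

/-- Symmetry of the mixed second partial derivatives. -/
lemma pdt_pdx (hf : ContDiff ℝ ∞ f) : pdt (pdx f) = pdx (pdt f) := by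
  rw [pdt_eq_fderiv (contDiff_pdx hf), pdx_eq_fderiv (contDiff_pdt hf), pdx_eq_fderiv hf,
    pdt_eq_fderiv hf]
  funext p
  have hd : DifferentiableAt ℝ (fderiv ℝ f) p :=
    (hf.fderiv_right (m := ∞) (by simp)).differentiable (by simp) p
  have hs : IsSymmSndFDerivAt ℝ f p :=
    hf.contDiffAt.isSymmSndFDerivAt (by
      rw [minSmoothness_of_isRCLikeNormedField]
      exact WithTop.coe_le_coe.2 (OrderTop.le_top 2))
  rw [fderiv_clm_apply hd (differentiableAt_const _), fderiv_clm_apply hd (differentiableAt_const _)]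
  simpa using hs (0, 1) (1, 0)

lemma pdx_add (hf : ContDiff ℝ ∞ f) (hg : ContDiff ℝ ∞ g) :
    pdx (fun p => f p + g p) = fun p => pdx f p + pdx g p :=
  funext fun p => ((hasDerivAt_pdx hf p).add (hasDerivAt_pdx hg p)).deriv

lemma pdx_sub (hf : ContDiff ℝ ∞ f) (hg : ContDiff ℝ ∞ g) :
    pdx (fun p => f p - g p) = fun p => pdx f p - pdx g p :=
  funext fun p => ((hasDerivAt_pdx hf p).sub (hasDerivAt_pdx hg p)).deriv

lemma pdx_neg (hf : ContDiff ℝ ∞ f) : pdx (fun p => -f p) = fun p => -pdx f p :=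
  funext fun p => (hasDerivAt_pdx hf p).neg.deriv

lemma pdx_mul (hf : ContDiff ℝ ∞ f) (hg : ContDiff ℝ ∞ g) :
    pdx (fun p => f p * g p) = fun p => pdx f p * g p + f p * pdx g p :=
  funext fun p => ((hasDerivAt_pdx hf p).mul (hasDerivAt_pdx hg p)).deriv

lemma pdx_const (c : ℝ) : pdx (fun _ => c) = fun _ => 0 :=
  funext fun p => (hasDerivAt_const p.1 c).deriv

lemma pdx_pow (hf : ContDiff ℝ ∞ f) (n : ℕ) :
    pdx (fun p => f p ^ n) = fun p => n * f p ^ (n - 1) * pdx f p :=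
  funext fun p => ((hasDerivAt_pdx hf p).pow n).deriv

end PartialDerivatives

/-- The Miura transformation `u = −w_x − (1/2)w²` maps solutions of the Fordy–Gibbons equation
to solutions of the Kaup–Kupershmidt equation `u_t = u_xxxxx + 10uu_xxx + 25u_xu_xx + 20u²u_x`. -/
theorem fordy_gibbons_to_kaup_kupershmidt
    (w u : ℝ × ℝ → ℝ) (hw : ContDiff ℝ (⊤ : ℕ∞) w)
    (hFG : ∀ p : ℝ × ℝ,
      pdt w p = pdx (pdx (pdx (pdx (pdx w)))) p
        - 5 * pdx w p * pdx (pdx (pdx w)) p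
        - 5 * (pdx (pdx w) p) ^ 2
        - 5 * (pdx w p) ^ 3
        - 20 * w p * pdx w p * pdx (pdx w) p
        - 5 * (w p) ^ 2 * pdx (pdx (pdx w)) p
        + 5 * (w p) ^ 4 * pdx w p)
    (hu : u = fun p => -pdx w p - (1 / 2) * (w p) ^ 2) :
    ∀ p : ℝ × ℝ,
      pdt u p = pdx (pdx (pdx (pdx (pdx u)))) p
        + 10 * u p * pdx (pdx (pdx u)) p
        + 25 * pdx u p * pdx (pdx u) p
        + 20 * (u p) ^ 2 * pdx u p := by
  have h0 : ContDiff ℝ ∞ w := hw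
  obtain ⟨w1, e1⟩ : ∃ v, pdx w = v := ⟨_, rfl⟩
  obtain ⟨w2, e2⟩ : ∃ v, pdx w1 = v := ⟨_, rfl⟩
  obtain ⟨w3, e3⟩ : ∃ v, pdx w2 = v := ⟨_, rfl⟩
  obtain ⟨w4, e4⟩ : ∃ v, pdx w3 = v := ⟨_, rfl⟩
  obtain ⟨w5, e5⟩ : ∃ v, pdx w4 = v := ⟨_, rfl⟩
  obtain ⟨w6, e6⟩ : ∃ v, pdx w5 = v := ⟨_, rfl⟩
  have h1 : ContDiff ℝ ∞ w1 := e1 ▸ contDiff_pdx h0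
  have h2 : ContDiff ℝ ∞ w2 := e2 ▸ contDiff_pdx h1
  have h3 : ContDiff ℝ ∞ w3 := e3 ▸ contDiff_pdx h2
  have h4 : ContDiff ℝ ∞ w4 := e4 ▸ contDiff_pdx h3
  have h5 : ContDiff ℝ ∞ w5 := e5 ▸ contDiff_pdx h4
  have hut : pdt u = fun p => -pdx (pdt w) p - w p * pdt w p := by
    rw [← pdt_pdx h0, hu]
    funext p
    refine ((hasDerivAt_pdt (contDiff_pdx h0) p).neg.sub
      (((hasDerivAt_pdt h0 p).pow 2).const_mul (1 / 2))).deriv.trans ?_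
    norm_num
    ring
  have hwt := funext hFG
  simp only [e1, e2, e3, e4, e5] at hwt hu
  have hwtx : pdx (pdt w) = fun p => w6 p - 5 * w1 p * w4 p - 15 * w2 p * w3 p
      - 35 * w1 p ^ 2 * w2 p - 20 * w p * w2 p ^ 2
      - 30 * w p * w1 p * w3 p - 5 * w p ^ 2 * w4 p + 20 * w p ^ 3 * w1 p ^ 2
      + 5 * w p ^ 4 * w2 p := by
    rw [hwt]
    simp (disch := fun_prop) only [pdx_add, pdx_sub, pdx_mul, pdx_const, pdx_pow,
      e1, e2, e3, e4, e6]
    funext p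
    norm_num
    ring
  have u1 : pdx u = fun p => -w2 p - w p * w1 p := by
    rw [hu]
    simp (disch := fun_prop) only [pdx_sub, pdx_neg, pdx_mul, pdx_const, pdx_pow, e1, e2]
    funext p
    norm_num
    ring
  have u2 : pdx (pdx u) = fun p => -w3 p - w1 p ^ 2 - w p * w2 p := by
    rw [u1]
    simp (disch := fun_prop) only [pdx_sub, pdx_neg, pdx_mul, e1, e2, e3]
    funext p
    ring
  have u3 : pdx (pdx (pdx u)) = fun p => -w4 p - 3 * (w1 p * w2 p) - w p * w3 p := by
    rw [u2]
    simp (disch := fun_prop) only [pdx_sub, pdx_neg, pdx_mul, pdx_pow, e1, e2, e3, e4]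
    funext p
    norm_num
    ring
  have u4 : pdx (pdx (pdx (pdx u))) = fun p =>
      -w5 p - 4 * (w1 p * w3 p) - 3 * w2 p ^ 2 - w p * w4 p := by
    rw [u3]
    simp (disch := fun_prop) only [pdx_sub, pdx_neg, pdx_mul, pdx_const, e1, e2, e3, e4, e5]
    funext p
    ring
  have u5 : pdx (pdx (pdx (pdx (pdx u)))) = fun p =>
      -w6 p - 10 * (w2 p * w3 p) - 5 * (w1 p * w4 p) - w p * w5 p := by
    rw [u4]
    simp (disch := fun_prop) only [pdx_sub, pdx_neg, pdx_mul, pdx_pow, pdx_const,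
      e1, e2, e3, e4, e5, e6]
    funext p
    norm_num
    ring
  intro p
  rw [u5, u3, u2, u1, hut, hwtx, hwt, hu]
  ring
end

section
/- Let u : ℝ × ℝ → ℝ be smooth, everywhere positive, and satisfy the Harry Dym equation u_t = −u³ u_xxx at every point. Let y : ℝ × ℝ → ℝ be smooth with ∂y/∂x = u⁻² and ∂y/∂t = 2 u_xx at every point, and let û : ℝ × ℝ → ℝ be a smooth function of (Y,τ) such that û(y(x,t), t) = u(x,t)⁻¹ for all (x,t). Then at every point of the form (Y,τ) = (y(x,t), t), û again satisfies the Harry Dym equation û_τ = −û³ û_YYY. Thus the Harry Dym equation is invariant under the reciprocal transformation dy = u⁻²dx + 2u_xx dt, u ↦ u⁻¹. -/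
/-- Partial derivative with respect to the first variable. -/
noncomputable def pd1 (f : ℝ × ℝ → ℝ) : ℝ × ℝ → ℝ := fun p => deriv (fun x => f (x, p.2)) p.1

/-- Partial derivative with respect to the second variable. -/
noncomputable def pd2 (f : ℝ × ℝ → ℝ) : ℝ × ℝ → ℝ := fun p => deriv (fun t => f (p.1, t)) p.2

theorem pd1_eq_fderiv {f : ℝ × ℝ → ℝ} (hf : Differentiable ℝ f) (p : ℝ × ℝ) :
    pd1 f p = fderiv ℝ f p (1, 0) := by
  have hline : HasDerivAt (fun x : ℝ => (x, p.2)) ((1 : ℝ), (0 : ℝ)) p.1 :=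
    (hasDerivAt_id p.1).prodMk (hasDerivAt_const p.1 p.2)
  exact ((hf p).hasFDerivAt.comp_hasDerivAt (f := fun x : ℝ => (x, p.2)) p.1 hline).deriv

theorem pd2_eq_fderiv {f : ℝ × ℝ → ℝ} (hf : Differentiable ℝ f) (p : ℝ × ℝ) :
    pd2 f p = fderiv ℝ f p (0, 1) := by
  have hline : HasDerivAt (fun t : ℝ => (p.1, t)) ((0 : ℝ), (1 : ℝ)) p.2 :=
    (hasDerivAt_const p.2 p.1).prodMk (hasDerivAt_id p.2)
  exact ((hf p).hasFDerivAt.comp_hasDerivAt (f := fun t : ℝ => (p.1, t)) p.2 hline).deriv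

theorem hasDerivAt_pd1 {f : ℝ × ℝ → ℝ} (hf : Differentiable ℝ f) (p : ℝ × ℝ) :
    HasDerivAt (fun x => f (x, p.2)) (pd1 f p) p.1 :=
  DifferentiableAt.hasDerivAt (by fun_prop)

theorem hasDerivAt_pd2 {f : ℝ × ℝ → ℝ} (hf : Differentiable ℝ f) (p : ℝ × ℝ) :
    HasDerivAt (fun t => f (p.1, t)) (pd2 f p) p.2 :=
  DifferentiableAt.hasDerivAt (by fun_prop)

theorem ContDiff.pd1 {f : ℝ × ℝ → ℝ} (hf : ContDiff ℝ (⊤ : ℕ∞) f) :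
    ContDiff ℝ (⊤ : ℕ∞) (pd1 f) := by
  have heq : _root_.pd1 f = fun p => fderiv ℝ f p (1, 0) :=
    funext (pd1_eq_fderiv (hf.differentiable (by simp)))
  rw [heq]
  exact (hf.fderiv_right (m := (⊤ : ℕ∞)) (by simp)).clm_apply contDiff_const

/-- Chain rule in the first variable for `p ↦ f (y p, p.2)`. -/
theorem pd1_comp_fst {f y : ℝ × ℝ → ℝ} (hf : Differentiable ℝ f) (hy : Differentiable ℝ y)
    (p : ℝ × ℝ) :
    pd1 (fun q => f (y q, q.2)) p = pd1 f (y p, p.2) * pd1 y p :=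
  ((hasDerivAt_pd1 hf (y p, p.2)).comp (h := fun x => y (x, p.2)) p.1
    (hasDerivAt_pd1 hy p)).deriv

/-- Chain rule in the second variable for `p ↦ f (y p, p.2)`. -/
theorem pd2_comp_fst {f y : ℝ × ℝ → ℝ} (hf : Differentiable ℝ f) (hy : Differentiable ℝ y)
    (p : ℝ × ℝ) :
    pd2 (fun q => f (y q, q.2)) p = pd1 f (y p, p.2) * pd2 y p + pd2 f (y p, p.2) := by
  have hcurve : HasDerivAt (fun t : ℝ => (y (p.1, t), t)) (pd2 y p, (1 : ℝ)) p.2 :=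
    (hasDerivAt_pd2 hy p).prodMk (hasDerivAt_id p.2)
  have hsplit : (pd2 y p, (1 : ℝ)) = pd2 y p • ((1 : ℝ), (0 : ℝ)) + ((0 : ℝ), (1 : ℝ)) := by
    simp
  have hderiv := ((hf (y p, p.2)).hasFDerivAt.comp_hasDerivAt
    (f := fun t : ℝ => (y (p.1, t), t)) p.2 hcurve).deriv
  rw [hsplit, map_add, map_smul, ← pd1_eq_fderiv hf, ← pd2_eq_fderiv hf, smul_eq_mul,
    mul_comm] at hderiv
  exact hderiv

/-- Invariance of the Harry Dym equation under the reciprocal transformation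
`dy = u⁻²dx + 2u_xx dt`, `û = u⁻¹`: if `u > 0` solves `u_t = −u³u_xxx`, `y` satisfies
`y_x = u⁻²`, `y_t = 2u_xx`, and `û(y(x,t), t) = u(x,t)⁻¹`, then `û` again solves the
Harry Dym equation `û_τ = −û³û_yyy` at every point `(y(x,t), t)`. -/
theorem harry_dym_reciprocal_invariance
    (u y uhat : ℝ × ℝ → ℝ)
    (hu : ContDiff ℝ (⊤ : ℕ∞) u) (hupos : ∀ p, 0 < u p)
    (hHD : ∀ p : ℝ × ℝ, pd2 u p = -(u p) ^ 3 * pd1 (pd1 (pd1 u)) p)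
    (hy : ContDiff ℝ (⊤ : ℕ∞) y)
    (hyx : ∀ p : ℝ × ℝ, pd1 y p = ((u p) ^ 2)⁻¹)
    (hyt : ∀ p : ℝ × ℝ, pd2 y p = 2 * pd1 (pd1 u) p)
    (huhat : ContDiff ℝ (⊤ : ℕ∞) uhat)
    (hcomp : ∀ p : ℝ × ℝ, uhat (y p, p.2) = (u p)⁻¹) :
    ∀ p : ℝ × ℝ,
      pd2 uhat (y p, p.2)
        = -(uhat (y p, p.2)) ^ 3 * pd1 (pd1 (pd1 uhat)) (y p, p.2) := by
  intro p
  have hdy : Differentiable ℝ y := hy.differentiable (by simp)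
  have hdu : Differentiable ℝ u := hu.differentiable (by simp)
  have hdu1 : Differentiable ℝ (pd1 u) := hu.pd1.differentiable (by simp)
  have hdu2 : Differentiable ℝ (pd1 (pd1 u)) := hu.pd1.pd1.differentiable (by simp)
  have hdv : Differentiable ℝ uhat := huhat.differentiable (by simp)
  have hdv1 : Differentiable ℝ (pd1 uhat) := huhat.pd1.differentiable (by simp)
  have hdv2 : Differentiable ℝ (pd1 (pd1 uhat)) := huhat.pd1.pd1.differentiable (by simp)
  have hne : ∀ q, u q ≠ 0 := fun q => (hupos q).ne'
  -- In the new coordinates, `∂_Y = u² ∂_x`.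
  have transport : ∀ f g : ℝ × ℝ → ℝ, Differentiable ℝ f → (∀ q, f (y q, q.2) = g q) →
      ∀ q, pd1 f (y q, q.2) = u q ^ 2 * pd1 g q := by
    intro f g hf hfg q
    have hchain := pd1_comp_fst hf hdy q
    rw [funext hfg, hyx] at hchain
    rw [hchain]
    field_simp [hne q]
  have hv1 : ∀ q, pd1 uhat (y q, q.2) = -pd1 u q := by
    intro q
    have hinv : pd1 (fun r => (u r)⁻¹) q = -pd1 u q / u q ^ 2 :=
      ((hasDerivAt_pd1 hdu q).inv (hne q)).deriv
    rw [transport uhat _ hdv hcomp q, hinv]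
    field_simp [hne q]
  have hv2 : ∀ q, pd1 (pd1 uhat) (y q, q.2) = -(u q ^ 2 * pd1 (pd1 u) q) := by
    intro q
    have hneg : pd1 (fun r => -pd1 u r) q = -pd1 (pd1 u) q := (hasDerivAt_pd1 hdu1 q).neg.deriv
    rw [transport _ _ hdv1 hv1 q, hneg, mul_neg]
  have hv3 : pd1 (pd1 (pd1 uhat)) (y p, p.2) =
      -(u p ^ 2 * (2 * u p * pd1 u p * pd1 (pd1 u) p + u p ^ 2 * pd1 (pd1 (pd1 u)) p)) := by
    have hprod := (((hasDerivAt_pd1 hdu p).pow 2).mul (hasDerivAt_pd1 hdu2 p)).neg.deriv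
    have hmul : pd1 (fun r => -(u r ^ 2 * pd1 (pd1 u) r)) p = _ := hprod
    rw [transport _ _ hdv2 hv2 p, hmul]
    simp
    ring
  have ht := pd2_comp_fst hdv hdy p
  have hinv : pd2 (fun r => (u r)⁻¹) p = -pd2 u p / u p ^ 2 :=
    ((hasDerivAt_pd2 hdu p).inv (hne p)).deriv
  rw [funext hcomp, hinv, hv1, hyt, hHD] at ht
  rw [hv3, hcomp, eq_sub_of_add_eq' ht.symm]
  have hp := hne p
  field_simp
  ring
end
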